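/- arXiv:2411.11136 — 2 statements merged into one kernel-verified Lean document; each statement's English description precedes it below -/
import Mathlib

section
/- Let k ≥ 2 be an integer, let G be a finite simple graph, let P be a k^+-star packing of G satisfying conditions (C1), (C2) and (C3), and let Q be any k^+-star packing of G. Then every c-vertex (i.e., every satellite of a Type-1 star of Q that is covered by P) is a satellite of a star of P having exactly k satellites, and no two distinct c-vertices belong to the same star of P. -/
open SimpleGraph

variable {V : Type*}

/-- A star in a graph `G`: a center together with a finite set of satellites, each
adjacent to the center.  An `ℓ`-star is such a star with `sats.card = ℓ`. -/
structure GStar (G : SimpleGraph V) where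
  center : V
  sats : Finset V
  center_not_mem : center ∉ sats
  adj : ∀ v ∈ sats, G.Adj center v

/-- The vertex set of a star. -/
def GStar.verts {G : SimpleGraph V} (S : GStar G) : Set V :=
  insert S.center ↑S.sats

/-- The set of vertices covered by a collection of stars. -/
def coverSet {G : SimpleGraph V} (P : Set (GStar G)) : Set V :=
  ⋃ S ∈ P, S.verts

/-- A `k⁺`-star packing: pairwise vertex-disjoint stars, each with at least `k` satellites. -/
def IsKPlusPacking {G : SimpleGraph V} (k : ℕ) (P : Set (GStar G)) : Prop :=
  (∀ S ∈ P, k ≤ S.sats.card) ∧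
  P.Pairwise fun S T => Disjoint S.verts T.verts

/-- (C1) no vertex uncovered by `P` has `k` or more uncovered neighbors, and no uncovered
vertex is adjacent to the center of a star of `P`. -/
def CondC1 {G : SimpleGraph V} (k : ℕ) (P : Set (GStar G)) : Prop :=
  ∀ v ∈ (coverSet P)ᶜ,
    (G.neighborSet v ∩ (coverSet P)ᶜ).ncard < k ∧
    ∀ S ∈ P, ¬ G.Adj v S.center

/-- (C2) for every star `S` of `P` with at least `k+1` satellites and every satellite `v`
of `S`, there is no `k⁺`-star of `G` whose vertex set lies in `{v} ∪ (V ∖ V(P))`. -/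
def CondC2 {G : SimpleGraph V} (k : ℕ) (P : Set (GStar G)) : Prop :=
  ∀ S ∈ P, k + 1 ≤ S.sats.card → ∀ v ∈ S.sats,
    ¬ ∃ T : GStar G, k ≤ T.sats.card ∧ T.verts ⊆ insert v (coverSet P)ᶜ

/-- (C3) for every star `S` of `P` with exactly `k` satellites, no `(k+1)⁺`-star and no
pair of vertex-disjoint `k`-stars fit inside `V(S) ∪ (V ∖ V(P))`. -/
def CondC3 {G : SimpleGraph V} (k : ℕ) (P : Set (GStar G)) : Prop :=
  ∀ S ∈ P, S.sats.card = k →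
    (¬ ∃ T : GStar G, k + 1 ≤ T.sats.card ∧ T.verts ⊆ S.verts ∪ (coverSet P)ᶜ) ∧
    (¬ ∃ T₁ T₂ : GStar G, T₁.sats.card = k ∧ T₂.sats.card = k ∧
        Disjoint T₁.verts T₂.verts ∧
        T₁.verts ⊆ S.verts ∪ (coverSet P)ᶜ ∧ T₂.verts ⊆ S.verts ∪ (coverSet P)ᶜ)

/-- (C4) for every `k`-star `S` of `P`, every `(k+1)⁺`-star `T` of `P` and every satellite
`x` of `T`, no pair of vertex-disjoint `k⁺`-stars fits inside `V(S) ∪ {x} ∪ (V ∖ V(P))`. -/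
def CondC4 {G : SimpleGraph V} (k : ℕ) (P : Set (GStar G)) : Prop :=
  ∀ S ∈ P, S.sats.card = k → ∀ T ∈ P, k + 1 ≤ T.sats.card → ∀ x ∈ T.sats,
    ¬ ∃ A B : GStar G, k ≤ A.sats.card ∧ k ≤ B.sats.card ∧
        Disjoint A.verts B.verts ∧
        A.verts ⊆ S.verts ∪ {x} ∪ (coverSet P)ᶜ ∧
        B.verts ⊆ S.verts ∪ {x} ∪ (coverSet P)ᶜ

/-- (C5) for every two distinct `k`-stars `S, T` of `P`, neither a vertex-disjoint pair
consisting of a `k⁺`-star and a `(k+1)⁺`-star, nor a triple of pairwise vertex-disjoint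
`k`-stars, fits inside `V(S) ∪ V(T) ∪ (V ∖ V(P))`. -/
def CondC5 {G : SimpleGraph V} (k : ℕ) (P : Set (GStar G)) : Prop :=
  ∀ S ∈ P, ∀ T ∈ P, S ≠ T → S.sats.card = k → T.sats.card = k →
    (¬ ∃ A B : GStar G, k ≤ A.sats.card ∧ k + 1 ≤ B.sats.card ∧
        Disjoint A.verts B.verts ∧
        A.verts ⊆ S.verts ∪ T.verts ∪ (coverSet P)ᶜ ∧
        B.verts ⊆ S.verts ∪ T.verts ∪ (coverSet P)ᶜ) ∧
    (¬ ∃ A B C : GStar G, A.sats.card = k ∧ B.sats.card = k ∧ C.sats.card = k ∧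
        Disjoint A.verts B.verts ∧ Disjoint A.verts C.verts ∧ Disjoint B.verts C.verts ∧
        A.verts ⊆ S.verts ∪ T.verts ∪ (coverSet P)ᶜ ∧
        B.verts ⊆ S.verts ∪ T.verts ∪ (coverSet P)ᶜ ∧
        C.verts ⊆ S.verts ∪ T.verts ∪ (coverSet P)ᶜ)

/-- (C6, for `k = 2`) for every three distinct `2`-stars `S, T, U` of `P`, no triple of
pairwise vertex-disjoint stars consisting of two `2`-stars and a `3⁺`-star fits inside
`V(S) ∪ V(T) ∪ V(U) ∪ (V ∖ V(P))`. -/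
def CondC6 {G : SimpleGraph V} (P : Set (GStar G)) : Prop :=
  ∀ S ∈ P, ∀ T ∈ P, ∀ U ∈ P, S ≠ T → S ≠ U → T ≠ U →
    S.sats.card = 2 → T.sats.card = 2 → U.sats.card = 2 →
    ¬ ∃ A B C : GStar G, A.sats.card = 2 ∧ B.sats.card = 2 ∧ 3 ≤ C.sats.card ∧
        Disjoint A.verts B.verts ∧ Disjoint A.verts C.verts ∧ Disjoint B.verts C.verts ∧
        A.verts ⊆ S.verts ∪ T.verts ∪ U.verts ∪ (coverSet P)ᶜ ∧
        B.verts ⊆ S.verts ∪ T.verts ∪ U.verts ∪ (coverSet P)ᶜ ∧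
        C.verts ⊆ S.verts ∪ T.verts ∪ U.verts ∪ (coverSet P)ᶜ

/-- A Type-1 star of `Q` (with respect to `P`): exactly `k` of its vertices are uncovered by `P`. -/
def IsType1Star {G : SimpleGraph V} (k : ℕ) (P : Set (GStar G)) (S : GStar G) : Prop :=
  (S.verts ∩ (coverSet P)ᶜ).ncard = k

/-- A `c`-vertex: a satellite of a Type-1 star of `Q` that is covered by `P`. -/
def IsCVertex {G : SimpleGraph V} (k : ℕ) (P Q : Set (GStar G)) (v : V) : Prop :=
  v ∈ coverSet P ∧ ∃ S ∈ Q, IsType1Star k P S ∧ v ∈ S.sats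

/-- An `a`-vertex: a vertex covered by `P` that is not a `c`-vertex and belongs to a star
of `P` containing some `c`-vertex. -/
def IsAVertex {G : SimpleGraph V} (k : ℕ) (P Q : Set (GStar G)) (v : V) : Prop :=
  v ∈ coverSet P ∧ ¬ IsCVertex k P Q v ∧
    ∃ T ∈ P, v ∈ T.verts ∧ ∃ c, IsCVertex k P Q c ∧ c ∈ T.verts

/-- The `a`-vertex `v` is associated with the `c`-vertex `c`: they lie in a common star of `P`. -/
def AVertexAssoc {G : SimpleGraph V} (k : ℕ) (P Q : Set (GStar G)) (v c : V) : Prop :=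
  v ∈ coverSet P ∧ ¬ IsCVertex k P Q v ∧ IsCVertex k P Q c ∧
    ∃ T ∈ P, v ∈ T.verts ∧ c ∈ T.verts

/-- The star with the same center as `S` and satellites `A`. -/
def GStar.restrict {G : SimpleGraph V} (S : GStar G) (A : Finset V) (hA : A ⊆ S.sats) :
    GStar G where
  center := S.center
  sats := A
  center_not_mem h := S.center_not_mem (hA h)
  adj v hv := S.adj v (hA hv)

/-- Adding a neighbor of the center as a new satellite. -/
def GStar.extend [DecidableEq V] {G : SimpleGraph V} (S : GStar G) (x : V)
    (hx : G.Adj S.center x) : GStar G where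
  center := S.center
  sats := insert x S.sats
  center_not_mem h := (Finset.mem_insert.mp h).elim hx.ne S.center_not_mem
  adj v hv := (Finset.mem_insert.mp hv).elim (fun h => h ▸ hx) (S.adj v)

theorem GStar.verts_subset_iff {G : SimpleGraph V} {S : GStar G} {W : Set V} :
    S.verts ⊆ W ↔ S.center ∈ W ∧ ∀ v ∈ S.sats, v ∈ W := by
  simp [GStar.verts, Set.subset_def]

theorem GStar.center_mem_verts {G : SimpleGraph V} (S : GStar G) : S.center ∈ S.verts :=
  Set.mem_insert _ _

theorem GStar.mem_verts_of_mem_sats {G : SimpleGraph V} {S : GStar G} {v : V}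
    (hv : v ∈ S.sats) : v ∈ S.verts :=
  Set.mem_insert_of_mem _ hv

theorem mem_coverSet {G : SimpleGraph V} {P : Set (GStar G)} {v : V} :
    v ∈ coverSet P ↔ ∃ T ∈ P, v ∈ T.verts := by
  simp [coverSet]

/-- A covered vertex with an uncovered neighbor is a satellite of a star of `P`. -/
theorem CondC1.exists_mem_sats {G : SimpleGraph V} {k : ℕ} {P : Set (GStar G)}
    (h1 : CondC1 k P) {u v : V} (hu : u ∉ coverSet P) (hv : v ∈ coverSet P)
    (huv : G.Adj u v) : ∃ T ∈ P, v ∈ T.sats := by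
  obtain ⟨T, hT, hvT⟩ := mem_coverSet.mp hv
  refine ⟨T, hT, hvT.resolve_left ?_⟩
  rintro rfl
  exact (h1 u hu).2 T hT huv

/-- A satellite of a star of `P` that together with uncovered vertices spans a `k⁺`-star
belongs to a star with exactly `k` satellites. -/
theorem CondC2.card_sats_eq {G : SimpleGraph V} {k : ℕ} {P : Set (GStar G)}
    (h2 : CondC2 k P) (hP : IsKPlusPacking k P) {T A : GStar G} (hT : T ∈ P) {v : V}
    (hv : v ∈ T.sats) (hA : k ≤ A.sats.card) (hAv : A.verts ⊆ insert v (coverSet P)ᶜ) :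
    T.sats.card = k := by
  refine ((hP.1 T hT).eq_or_lt.resolve_right fun hlt => ?_).symm
  exact h2 T hT hlt v hv ⟨A, hA, hAv⟩

/-- A `k⁺`-star with only uncovered satellites has an uncovered center. -/
theorem center_notMem_coverSet {G : SimpleGraph V} {k : ℕ} (hk : 1 ≤ k) {P : Set (GStar G)}
    (hP : IsKPlusPacking k P) (h1 : CondC1 k P) (h2 : CondC2 k P) (h3 : CondC3 k P)
    (A : GStar G) (hA : k ≤ A.sats.card) (hAU : ∀ v ∈ A.sats, v ∉ coverSet P) :
    A.center ∉ coverSet P := by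
  classical
  intro hc
  obtain ⟨u, hu⟩ : A.sats.Nonempty := Finset.card_pos.mp (by omega)
  obtain ⟨T, hT, hcT⟩ := h1.exists_mem_sats (hAU u hu) hc (A.adj u hu).symm
  have hTk : T.sats.card = k := h2.card_sats_eq hP hT hcT hA <|
    GStar.verts_subset_iff.mpr ⟨Or.inl rfl, fun v hv => Or.inr (hAU v hv)⟩
  have hTA : T.center ∉ A.sats := fun h =>
    hAU _ h (mem_coverSet.mpr ⟨T, hT, T.center_mem_verts⟩)
  refine (h3 T hT hTk).1 ⟨A.extend T.center (T.adj _ hcT).symm, ?_, ?_⟩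
  · simpa [GStar.extend, Finset.card_insert_of_notMem hTA] using hA
  · refine GStar.verts_subset_iff.mpr
      ⟨Or.inl (GStar.mem_verts_of_mem_sats hcT), fun v hv => ?_⟩
    rcases Finset.mem_insert.mp hv with rfl | hv
    · exact Or.inl T.center_mem_verts
    · exact Or.inr (hAU v hv)

/-- A Type-1 star has an uncovered center and exactly `k - 1` uncovered
satellites. -/
theorem IsType1Star.exists_restrict {G : SimpleGraph V} {k : ℕ} (hk : 1 ≤ k)
    {P : Set (GStar G)} (hP : IsKPlusPacking k P) (h1 : CondC1 k P) (h2 : CondC2 k P)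
    (h3 : CondC3 k P) {S : GStar G} (hS : IsType1Star k P S) :
    ∃ A : GStar G, A.center = S.center ∧ A.sats ⊆ S.sats ∧ A.sats.card + 1 = k ∧
      A.verts ⊆ (coverSet P)ᶜ := by
  classical
  set A := S.restrict (S.sats.filter (· ∉ coverSet P)) (Finset.filter_subset _ _) with hAdef
  have hAU : ∀ v ∈ A.sats, v ∉ coverSet P := fun v hv => (Finset.mem_filter.mp hv).2
  have hc : S.center ∉ coverSet P := by
    intro hc
    have hset : S.verts ∩ (coverSet P)ᶜ = ↑A.sats := by
      ext v
      simp only [GStar.verts, hAdef, GStar.restrict, Set.mem_inter_iff, Set.mem_insert_iff,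
        Set.mem_compl_iff, Finset.coe_filter, Set.mem_ofPred_eq, Finset.mem_coe]
      grind
    have hcard : A.sats.card = k := by
      rw [← Set.ncard_coe_finset, ← hset]
      exact hS
    exact center_notMem_coverSet hk hP h1 h2 h3 A hcard.ge hAU hc
  have hset : S.verts ∩ (coverSet P)ᶜ = ↑(insert S.center A.sats) := by
    ext v
    simp only [GStar.verts, hAdef, GStar.restrict, Set.mem_inter_iff, Set.mem_insert_iff,
      Set.mem_compl_iff, Finset.coe_filter, Set.mem_ofPred_eq, Finset.mem_coe,
      Finset.coe_insert]
    grind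
  refine ⟨A, rfl, Finset.filter_subset _ _, ?_, GStar.verts_subset_iff.mpr ⟨hc, hAU⟩⟩
  rw [← Finset.card_insert_of_notMem A.center_not_mem, ← Set.ncard_coe_finset]
  exact (congrArg Set.ncard hset).symm.trans hS

/-- Each `c`-vertex `v` lies in a `k`-star contained in a star of `Q`, all of whose vertices
except the satellite `v` are uncovered by `P`. -/
theorem IsCVertex.exists_star {G : SimpleGraph V} {k : ℕ} (hk : 1 ≤ k) {P Q : Set (GStar G)}
    (hP : IsKPlusPacking k P) (h1 : CondC1 k P) (h2 : CondC2 k P) (h3 : CondC3 k P)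
    {v : V} (hv : IsCVertex k P Q v) :
    ∃ S ∈ Q, v ∈ S.sats ∧ ∃ B : GStar G, B.center = S.center ∧
      B.sats ⊆ S.sats ∧ B.sats.card = k ∧ v ∈ B.sats ∧ B.center ∉ coverSet P ∧
      B.verts ⊆ insert v (coverSet P)ᶜ := by
  classical
  obtain ⟨hvP, S, hSQ, hS, hvS⟩ := hv
  obtain ⟨A, hAc, hAS, hAk, hAU⟩ := hS.exists_restrict hk hP h1 h2 h3
  obtain ⟨hcU, hsU⟩ := GStar.verts_subset_iff.mp hAU
  refine ⟨S, hSQ, hvS, A.extend v (hAc ▸ S.adj v hvS), hAc,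
    Finset.insert_subset hvS hAS, ?_, Finset.mem_insert_self _ _, hcU, ?_⟩
  · exact (Finset.card_insert_of_notMem fun h => hsU v h hvP).trans hAk
  · exact GStar.verts_subset_iff.mpr ⟨Or.inr hcU, fun w hw =>
      (Finset.mem_insert.mp hw).imp id (hsU w)⟩

theorem IsCVertex.exists_mem_sats {G : SimpleGraph V} {k : ℕ} (hk : 1 ≤ k)
    {P Q : Set (GStar G)} (hP : IsKPlusPacking k P) (h1 : CondC1 k P) (h2 : CondC2 k P)
    (h3 : CondC3 k P) {v : V} (hv : IsCVertex k P Q v) :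
    ∃ T ∈ P, T.sats.card = k ∧ v ∈ T.sats := by
  obtain ⟨S, -, -, B, -, -, hBk, hvB, hBc, hBU⟩ := hv.exists_star hk hP h1 h2 h3
  obtain ⟨T, hT, hvT⟩ := h1.exists_mem_sats hBc hv.1 (B.adj v hvB)
  exact ⟨T, hT, h2.card_sats_eq hP hT hvT hBk.ge hBU, hvT⟩

theorem IsKPlusPacking.eq_of_mem_verts {G : SimpleGraph V} {k : ℕ} {P : Set (GStar G)}
    (hP : IsKPlusPacking k P) {S T : GStar G} (hS : S ∈ P) (hT : T ∈ P) {v : V}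
    (hvS : v ∈ S.verts) (hvT : v ∈ T.verts) : S = T := by
  by_contra hne
  exact Set.disjoint_left.mp (hP.2 hS hT hne) hvS hvT

/-- Lemma 4 of the paper: every `c`-vertex is a satellite of a `k`-star of `P`, and no two
distinct `c`-vertices belong to the same star of `P`. -/
theorem cvertex_structure [Fintype V] (G : SimpleGraph V) (k : ℕ) (hk : 2 ≤ k)
    (P : Set (GStar G)) (hP : IsKPlusPacking k P)
    (h1 : CondC1 k P) (h2 : CondC2 k P) (h3 : CondC3 k P)
    (Q : Set (GStar G)) (hQ : IsKPlusPacking k Q) :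
    (∀ v : V, IsCVertex k P Q v → ∃ T ∈ P, T.sats.card = k ∧ v ∈ T.sats) ∧
    (∀ v w : V, IsCVertex k P Q v → IsCVertex k P Q w → v ≠ w →
      ∀ T ∈ P, v ∈ T.verts → w ∉ T.verts) := by
  classical
  have hk1 : 1 ≤ k := by omega
  refine ⟨fun v hv => hv.exists_mem_sats hk1 hP h1 h2 h3, fun v w hv hw hvw T hT hvT hwT => ?_⟩
  have hTk : T.sats.card = k := by
    obtain ⟨T', hT', hTk', hvT'⟩ := hv.exists_mem_sats hk1 hP h1 h2 h3
    rwa [hP.eq_of_mem_verts hT hT' hvT (GStar.mem_verts_of_mem_sats hvT')]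
  obtain ⟨S₁, hS₁, -, B₁, hc₁, hB₁, hBk₁, -, -, hBU₁⟩ := hv.exists_star hk1 hP h1 h2 h3
  obtain ⟨S₂, hS₂, hwS, B₂, hc₂, hB₂, hBk₂, -, -, hBU₂⟩ :=
    hw.exists_star hk1 hP h1 h2 h3
  have hBT₁ : B₁.verts ⊆ T.verts ∪ (coverSet P)ᶜ :=
    hBU₁.trans (Set.insert_subset (Or.inl hvT) Set.subset_union_right)
  have hBT₂ : B₂.verts ⊆ T.verts ∪ (coverSet P)ᶜ :=
    hBU₂.trans (Set.insert_subset (Or.inl hwT) Set.subset_union_right)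
  by_cases hS : S₁ = S₂
  · subst hS
    have hwB : w ∉ B₁.sats := fun h =>
      (hBU₁ (GStar.mem_verts_of_mem_sats h)).elim hvw.symm fun hwU => hwU hw.1
    refine (h3 T hT hTk).1 ⟨B₁.extend w (hc₁ ▸ S₁.adj w hwS), ?_, ?_⟩
    · simp [GStar.extend, Finset.card_insert_of_notMem hwB, hBk₁]
    · obtain ⟨hc, hs⟩ := GStar.verts_subset_iff.mp hBT₁
      exact GStar.verts_subset_iff.mpr ⟨hc, fun x hx =>
        (Finset.mem_insert.mp hx).elim (fun h => h ▸ Or.inl hwT) (hs x)⟩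
  · have hsub : ∀ {B S : GStar G}, B.center = S.center → B.sats ⊆ S.sats →
        B.verts ⊆ S.verts := fun hc hB =>
      GStar.verts_subset_iff.mpr ⟨hc ▸ GStar.center_mem_verts _, fun _ hx =>
        GStar.mem_verts_of_mem_sats (hB hx)⟩
    exact (h3 T hT hTk).2 ⟨B₁, B₂, hBk₁, hBk₂,
      (hQ.2 hS₁ hS₂ hS).mono (hsub hc₁ hB₁) (hsub hc₂ hB₂), hBT₁, hBT₂⟩
end

section
/- Let G be a finite simple graph, let P be a 2^+-star packing of G (i.e., k = 2) satisfying conditions (C1), (C2), (C3), (C4) and (C5), and let Q be any 2^+-star packing of G. Then every Type-2 star of Q (a star of Q exactly one of whose vertices is uncovered by P) contains no a-vertex. -/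
open SimpleGraph

variable {V : Type*}

namespace GStar

variable {G : SimpleGraph V}

theorem exists_verts_eq_triple {a b c : V} (hab : G.Adj a b) (hac : G.Adj a c) (hbc : b ≠ c) :
    ∃ S : GStar G, S.sats.card = 2 ∧ S.verts = {a, b, c} := by
  classical
  refine ⟨⟨a, {b, c}, ?_, ?_⟩, Finset.card_pair hbc, by simp [verts]⟩
  · simp [hab.ne, hac.ne]
  · simp [hab, hac]

theorem exists_verts_eq_quadruple {a b c d : V} (hab : G.Adj a b) (hac : G.Adj a c)
    (had : G.Adj a d) (hbc : b ≠ c) (hbd : b ≠ d) (hcd : c ≠ d) :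
    ∃ S : GStar G, S.sats.card = 3 ∧ S.verts = {a, b, c, d} := by
  classical
  refine ⟨⟨a, {b, c, d}, ?_, ?_⟩, Finset.card_eq_three.2 ⟨b, c, d, hbc, hbd, hcd, rfl⟩,
    by simp [verts]⟩
  · simp [hab.ne, hac.ne, had.ne]
  · simp [hab, hac, had]

theorem center_mem_verts_s6 (S : GStar G) : S.center ∈ S.verts := Set.mem_insert _ _

theorem mem_verts_of_mem_sats_s6 {S : GStar G} {v : V} (hv : v ∈ S.sats) : v ∈ S.verts :=
  Set.mem_insert_of_mem _ hv

theorem ne_center_of_mem_sats {S : GStar G} {v : V} (hv : v ∈ S.sats) : v ≠ S.center :=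
  fun h => S.center_not_mem (h ▸ hv)

end GStar

section Packing

open GStar

variable {G : SimpleGraph V} {P : Set (GStar G)}

theorem mem_coverSet_of_mem_verts {S : GStar G} (hS : S ∈ P) {v : V} (hv : v ∈ S.verts) :
    v ∈ coverSet P :=
  Set.mem_biUnion hS hv

theorem ne_of_notMem_coverSet {S : GStar G} (hS : S ∈ P) {v u : V} (hv : v ∈ S.verts)
    (hu : u ∉ coverSet P) : v ≠ u :=
  fun h => hu (h ▸ mem_coverSet_of_mem_verts hS hv)

theorem CondC1.mem_sats_of_adj {k : ℕ} (h1 : CondC1 k P) {S : GStar G} (hS : S ∈ P) {u v : V}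
    (hu : u ∉ coverSet P) (hv : v ∈ S.verts) (huv : G.Adj u v) : v ∈ S.sats := by
  rcases hv with rfl | hv
  · exact absurd huv ((h1 u hu).2 S hS)
  · exact hv

/-- A covered vertex of a packing does not have two uncovered neighbors. -/
theorem not_adj_two_uncovered (hP : IsKPlusPacking 2 P) (h1 : CondC1 2 P) (h2 : CondC2 2 P)
    (h3 : CondC3 2 P) {d x y : V} (hd : d ∈ coverSet P) (hx : x ∉ coverSet P)
    (hy : y ∉ coverSet P) (hxy : x ≠ y) (hdx : G.Adj d x) : ¬ G.Adj d y := by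
  intro hdy
  obtain ⟨T, hT, hdT⟩ : ∃ T ∈ P, d ∈ T.verts := by simpa [coverSet] using hd
  have hds := h1.mem_sats_of_adj hT hx hdT hdx.symm
  have hc := T.center_mem_verts_s6
  rcases (hP.1 T hT).eq_or_lt with h | h
  · obtain ⟨A, hA, hAv⟩ := exists_verts_eq_quadruple (T.adj d hds).symm hdx hdy
      (ne_of_notMem_coverSet hT hc hx) (ne_of_notMem_coverSet hT hc hy) hxy
    refine (h3 T hT h.symm).1 ⟨A, hA.ge, ?_⟩
    rw [hAv]
    rintro w (rfl | rfl | rfl | rfl) <;> simp [*]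
  · obtain ⟨A, hA, hAv⟩ := exists_verts_eq_triple hdx hdy hxy
    refine h2 T hT h d hds ⟨A, hA.ge, ?_⟩
    rw [hAv]
    rintro w (rfl | rfl | rfl) <;> simp [*]

/-- If a satellite of a `2`-star continues to a path of uncovered vertices, the other satellite
has no further uncovered neighbor. -/
theorem not_adj_uncovered_of_path (h3 : CondC3 2 P) {T : GStar G} (hT : T ∈ P)
    (hT2 : T.sats.card = 2) {c s d e u : V} (hc : c ∈ T.sats) (hs : s ∈ T.sats) (hsc : s ≠ c)
    (hd : d ∉ coverSet P) (he : e ∉ coverSet P) (hu : u ∉ coverSet P)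
    (hdc : G.Adj d c) (hde : G.Adj d e) (hud : u ≠ d) (hue : u ≠ e) : ¬ G.Adj s u := by
  intro hsu
  have hcT := mem_verts_of_mem_sats_s6 hc
  have hsT := mem_verts_of_mem_sats_s6 hs
  have htT := T.center_mem_verts_s6
  obtain ⟨A, hA, hAv⟩ := exists_verts_eq_triple hdc hde (ne_of_notMem_coverSet hT hcT he)
  obtain ⟨B, hB, hBv⟩ := exists_verts_eq_triple hsu (T.adj s hs).symm
    (ne_of_notMem_coverSet hT htT hu).symm
  refine (h3 T hT hT2).2 ⟨A, B, hA, hB, ?_, ?_, ?_⟩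
  · have := ne_of_notMem_coverSet hT hsT hd
    have := ne_of_notMem_coverSet hT hsT he
    have := ne_of_notMem_coverSet hT hcT hu
    have := ne_of_notMem_coverSet hT htT hd
    have := ne_of_notMem_coverSet hT htT he
    have := ne_center_of_mem_sats hc
    rw [hAv, hBv, Set.disjoint_left]
    rintro w (rfl | rfl | rfl) (h | h | h) <;> simp_all
  · rw [hAv]
    rintro w (rfl | rfl | rfl) <;> simp [*]
  · rw [hBv]
    rintro w (rfl | rfl | rfl) <;> simp [*]

/-- If a satellite `c` of a `2`-star `T` continues to a path of uncovered vertices, no vertex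
outside `T` is adjacent to both a vertex of `T` other than `c` and a further uncovered vertex. -/
theorem not_adj_of_path_of_adj_uncovered (hP : IsKPlusPacking 2 P) (h1 : CondC1 2 P)
    (h4 : CondC4 2 P) (h5 : CondC5 2 P) {T T' : GStar G} (hT : T ∈ P) (hT2 : T.sats.card = 2)
    (hT' : T' ∈ P) (hTT' : T ≠ T') {c v r d e u : V} (hc : c ∈ T.sats) (hv : v ∈ T.verts)
    (hvc : v ≠ c) (hr : r ∈ T'.verts)
    (hd : d ∉ coverSet P) (he : e ∉ coverSet P) (hu : u ∉ coverSet P)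
    (hdc : G.Adj d c) (hde : G.Adj d e) (hud : u ≠ d) (hue : u ≠ e) (hru : G.Adj r u) :
    ¬ G.Adj r v := by
  intro hrv
  have hrs := h1.mem_sats_of_adj hT' hu hr hru.symm
  have hcT := mem_verts_of_mem_sats_s6 hc
  have htT' := T'.center_mem_verts_s6
  have hdisj := Set.disjoint_left.1 (hP.2 hT hT' hTT')
  have hrc : r ≠ c := fun h => hdisj hcT (h ▸ hr)
  have htc : T'.center ≠ c := fun h => hdisj hcT (h ▸ htT')
  have hvt : v ≠ T'.center := fun h => hdisj hv (h ▸ htT')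
  have := ne_of_notMem_coverSet hT' hr hd
  have := ne_of_notMem_coverSet hT' hr he
  have := ne_of_notMem_coverSet hT hcT hu
  have := ne_of_notMem_coverSet hT hv hd
  have := ne_of_notMem_coverSet hT hv he
  have := ne_of_notMem_coverSet hT' htT' hd
  have := ne_of_notMem_coverSet hT' htT' he
  obtain ⟨A, hA, hAv⟩ := exists_verts_eq_triple hdc hde (ne_of_notMem_coverSet hT hcT he)
  have huv := (ne_of_notMem_coverSet hT hv hu).symm
  rcases (hP.1 T' hT').eq_or_lt with h | h
  · obtain ⟨B, hB, hBv⟩ := exists_verts_eq_quadruple hru hrv (T'.adj r hrs).symm huv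
      (ne_of_notMem_coverSet hT' htT' hu).symm hvt
    refine (h5 T hT T' hT' hTT' hT2 h.symm).1 ⟨A, B, hA.ge, hB.ge, ?_, ?_, ?_⟩
    · rw [hAv, hBv, Set.disjoint_left]
      rintro w (rfl | rfl | rfl) (h | h | h | h) <;> simp_all
    · rw [hAv]
      rintro w (rfl | rfl | rfl) <;> simp [*]
    · rw [hBv]
      rintro w (rfl | rfl | rfl | rfl) <;> simp [*]
  · obtain ⟨B, hB, hBv⟩ := exists_verts_eq_triple hru hrv huv
    refine h4 T hT hT2 T' hT' h r hrs ⟨A, B, hA.ge, hB.ge, ?_, ?_, ?_⟩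
    · rw [hAv, hBv, Set.disjoint_left]
      rintro w (rfl | rfl | rfl) (h | h | h) <;> simp_all
    · rw [hAv]
      rintro w (rfl | rfl | rfl) <;> simp [*]
    · rw [hBv]
      rintro w (rfl | rfl | rfl) <;> simp [*]

/-- A Type-1 star with a covered satellite `c` has an uncovered center adjacent to an uncovered
satellite, and `c` is a satellite of a `2`-star of the packing. -/
theorem IsType1Star.exists_uncovered_path (hP : IsKPlusPacking 2 P) (h1 : CondC1 2 P)
    (h2 : CondC2 2 P) (h3 : CondC3 2 P) {D T : GStar G} (hD : IsType1Star 2 P D) (hT : T ∈ P)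
    {c : V} (hcT : c ∈ T.verts) (hcD : c ∈ D.sats) :
    D.center ∉ coverSet P ∧ T.sats.card = 2 ∧ c ∈ T.sats ∧ ∃ e ∈ D.sats, e ∉ coverSet P := by
  obtain ⟨x, y, hxy, hset⟩ := Set.ncard_eq_two.1 hD
  have hx : x ∈ D.verts ∩ (coverSet P)ᶜ := hset ▸ by simp
  have hy : y ∈ D.verts ∩ (coverSet P)ᶜ := hset ▸ by simp
  have hd : D.center ∉ coverSet P := by
    intro hd
    have key : ∀ z ∈ D.verts ∩ (coverSet P)ᶜ, G.Adj D.center z := by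
      rintro z ⟨rfl | hz, hz'⟩
      · exact absurd hd hz'
      · exact D.adj z hz
    exact not_adj_two_uncovered hP h1 h2 h3 hd hx.2 hy.2 hxy (key x hx) (key y hy)
  obtain ⟨e, he, he'⟩ : ∃ e ∈ D.sats, e ∉ coverSet P := by
    rcases hx with ⟨hx | hx, hx'⟩
    · rcases hy with ⟨hy | hy, hy'⟩
      · exact absurd (hx.trans hy.symm) hxy
      · exact ⟨y, hy, hy'⟩
    · exact ⟨x, hx, hx'⟩
  have hdc := D.adj c hcD
  have hcs := h1.mem_sats_of_adj hT hd hcT hdc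
  refine ⟨hd, ?_, hcs, e, he, he'⟩
  by_contra hne
  obtain ⟨A, hA, hAv⟩ := exists_verts_eq_triple hdc (D.adj e he)
    (ne_of_notMem_coverSet hT hcT he')
  refine h2 T hT (lt_of_le_of_ne (hP.1 T hT) (Ne.symm hne)) c hcs ⟨A, hA.ge, ?_⟩
  rw [hAv]
  rintro w (rfl | rfl | rfl) <;> simp [*]

end Packing

/-- Lemma 6 of the paper (`k = 2`): under (C1)–(C5), every Type-2 star of `Q` (a star of
`Q` exactly one of whose vertices is uncovered by `P`) contains no `a`-vertex. -/
theorem type2_no_avertex_k2 [Fintype V] (G : SimpleGraph V)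
    (P : Set (GStar G)) (hP : IsKPlusPacking 2 P)
    (h1 : CondC1 2 P) (h2 : CondC2 2 P) (h3 : CondC3 2 P)
    (h4 : CondC4 2 P) (h5 : CondC5 2 P)
    (Q : Set (GStar G)) (hQ : IsKPlusPacking 2 Q) :
    ∀ S ∈ Q, (S.verts ∩ (coverSet P)ᶜ).ncard = 1 →
      ∀ v ∈ S.verts, ¬ IsAVertex 2 P Q v := by
  rintro R hR hR1 v hvR ⟨hvP, hvc, T, hT, hvT, c, hc, hcT⟩
  obtain ⟨-, D, hD, hD1, hcD⟩ := id hc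
  obtain ⟨hd, hT2, hcs, e, heD, he⟩ := hD1.exists_uncovered_path hP h1 h2 h3 hT hcT hcD
  have hDR : D ≠ R := by
    rintro rfl
    have : (D.verts ∩ (coverSet P)ᶜ).ncard = 2 := hD1
    omega
  have hdisj := Set.disjoint_left.1 (hQ.2 hD hR hDR)
  have hne : v ≠ c := fun h => hvc (h ▸ hc)
  obtain ⟨u, hu⟩ := Set.ncard_eq_one.1 hR1
  have huR : u ∈ R.verts ∩ (coverSet P)ᶜ := hu ▸ Set.mem_singleton u
  have hcov : ∀ w ∈ R.verts, w ≠ u → w ∈ coverSet P := fun w hw hwu =>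
    by_contra fun h => hwu (hu ▸ (⟨hw, h⟩ : w ∈ R.verts ∩ (coverSet P)ᶜ) : w ∈ ({u} : Set V))
  have hdc := D.adj c hcD
  have hde := D.adj e heD
  have hud : u ≠ D.center := fun h => hdisj D.center_mem_verts_s6 (h ▸ huR.1)
  have hue : u ≠ e := fun h => hdisj (GStar.mem_verts_of_mem_sats_s6 heD) (h ▸ huR.1)
  have hcu : ∀ w ∈ T.verts, w ≠ c → ¬ G.Adj w u := fun w hw hwc h =>
    not_adj_uncovered_of_path h3 hT hT2 hcs (h1.mem_sats_of_adj hT huR.2 hw h.symm) hwc hd he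
      huR.2 hdc hde hud hue h
  have huv : u ≠ v := (ne_of_notMem_coverSet hT hvT huR.2).symm
  rcases huR.1 with huc | hus
  · have hvs : v ∈ R.sats := hvR.resolve_left fun h => huv (huc.trans h.symm)
    exact hcu v hvT hne (huc ▸ (R.adj v hvs).symm)
  · have hru := R.adj u hus
    obtain hvr | hvs := hvR
    · exact hcu v hvT hne (hvr ▸ hru)
    · have hrP := hcov R.center R.center_mem_verts_s6 hru.ne
      obtain ⟨T', hT', hrT'⟩ : ∃ T' ∈ P, R.center ∈ T'.verts := by simpa [coverSet] using hrP
      have hTT' : T ≠ T' := by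
        rintro rfl
        exact hcu _ hrT' (fun h => hdisj (GStar.mem_verts_of_mem_sats_s6 hcD)
          (h ▸ R.center_mem_verts_s6)) hru
      exact not_adj_of_path_of_adj_uncovered hP h1 h4 h5 hT hT2 hT' hTT' hcs hvT hne hrT' hd he
        huR.2 hdc hde hud hue hru (R.adj v hvs)
end
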